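/- Let V be a finite-dimensional real vector space with dual space V*, let δ ⊆ V be a polyhedral cone (the set of non-negative linear combinations of a finite set of vectors), and let δ^∨ ⊆ V* denote its dual cone. Let W ⊆ V be a linear subspace and W^⊥ ⊆ V* its annihilator. Then for every x ∈ δ and every y ∈ δ^∨, one has inf { y(x') : x' ∈ (x + W) ∩ δ } + inf { y'(x) : y' ∈ (y + W^⊥) ∩ δ^∨ } = y(x). (Both sets are nonempty, since they contain x and y respectively, and both infima are non-negative since x ∈ δ and y ∈ δ^∨.) -/

import Mathlib

/-- A functional vanishing on `E` and equal to one at a vector outside `E`. -/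
theorem exists_dual_one_aux {V : Type*} [AddCommGroup V] [Module ℝ V] (E : Submodule ℝ V)
    (a : V) (ha : a ∉ E) : ∃ h : Module.Dual ℝ V, h a = 1 ∧ ∀ e ∈ E, h e = 0 := by
  obtain ⟨f, hfa, hf⟩ := Submodule.exists_le_ker_of_notMem ha
  refine ⟨(f a)⁻¹ • f, by simp [hfa], fun e he => ?_⟩
  have : f e = 0 := hf he
  simp [this]

/-- Algebraic extension of a functional that is nonnegative on a finitely generated cone. -/
theorem cone_extension_aux {V : Type*} [AddCommGroup V] [Module ℝ V] (s : Finset V) :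
    ∀ (E : Submodule ℝ V) (f : Module.Dual ℝ V),
      (∀ c : V → ℝ, (∀ v, 0 ≤ c v) → ∑ v ∈ s, c v • v ∈ E → 0 ≤ f (∑ v ∈ s, c v • v)) →
      ∃ g : Module.Dual ℝ V, (∀ e ∈ E, g e = f e) ∧ ∀ v ∈ s, 0 ≤ g v := by
  classical
  induction s using Finset.induction_on with
  | empty => intro E f _; exact ⟨f, by simp, by simp⟩
  | insert a s ha ih =>
    intro E f hf
    have key : ∀ (c : V → ℝ) (l : ℝ), (∀ v, 0 ≤ c v) → 0 ≤ l →
        ∑ v ∈ s, c v • v + l • a ∈ E → 0 ≤ f (∑ v ∈ s, c v • v + l • a) := by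
      intro c l hc hl hE
      have heq : ∑ v ∈ insert a s, (Function.update c a l) v • v
          = ∑ v ∈ s, c v • v + l • a := by
        rw [Finset.sum_insert ha, Function.update_self, add_comm]
        congr 1
        refine Finset.sum_congr rfl fun v hv => ?_
        rw [Function.update_of_ne (ne_of_mem_of_not_mem hv ha)]
      have := hf (Function.update c a l) ?_ (by rw [heq]; exact hE)
      · rwa [heq] at this
      · intro v
        by_cases h : v = a
        · subst h; simpa using hl
        · rw [Function.update_of_ne h]; exact hc v
    obtain ⟨g, hgE, hgs⟩ := ih E f (fun c hc hE => by
      simpa using key c 0 hc le_rfl (by simpa using hE))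
    by_cases hga : 0 ≤ g a
    · refine ⟨g, hgE, fun v hv => ?_⟩
      rcases Finset.mem_insert.1 hv with rfl | hv
      exacts [hga, hgs v hv]
    by_cases haE : a ∈ E
    · refine absurd ?_ hga
      rw [hgE a haE]
      simpa using key 0 1 (by simp) zero_le_one (by simpa using haE)
    obtain ⟨h, hha, hhE⟩ := exists_dual_one_aux E a haE
    obtain ⟨k, hkE, hks⟩ := ih (E ⊔ Submodule.span ℝ {a}) (f - f a • h) (by
      intro c hc hE
      obtain ⟨e, he, z, hz, hez⟩ := Submodule.mem_sup.1 hE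
      obtain ⟨l, rfl⟩ := Submodule.mem_span_singleton.1 hz
      have hval : (f - f a • h) (∑ v ∈ s, c v • v) = f e := by
        rw [← hez]; simp [hha, hhE e he]; ring
      rw [hval]
      by_contra hneg
      rcases le_or_gt l 0 with hl | hl
      · have h1 : ∑ v ∈ s, c v • v + (-l) • a = e := by rw [← hez]; simp
        have := key c (-l) hc (by linarith) (by rw [h1]; exact he)
        rw [h1] at this
        exact hneg this
      · have h1 : 0 ≤ g (∑ v ∈ s, c v • v) := by
          rw [map_sum]
          refine Finset.sum_nonneg fun v hv => ?_
          rw [map_smul, smul_eq_mul]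
          exact mul_nonneg (hc v) (hgs v hv)
        rw [← hez, map_add, map_smul, smul_eq_mul, hgE e he] at h1
        nlinarith)
    refine ⟨k, fun e he => ?_, fun v hv => ?_⟩
    · rw [hkE e (Submodule.mem_sup_left he)]; simp [hhE e he]
    · rcases Finset.mem_insert.1 hv with rfl | hv
      · rw [hkE v (Submodule.mem_sup_right (Submodule.mem_span_singleton_self v))]
        simp [hha]
      · exact hks v hv

/-- Lemma 4.1 of the paper.
Let `V` be a finite-dimensional real vector space, `δ ⊆ V` a polyhedral cone
(the set of non-negative linear combinations of a finite set of vectors),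
`δ^∨ ⊆ V*` its dual cone, `W ⊆ V` a linear subspace with annihilator `W^⊥ ⊆ V*`.
Then for `x ∈ δ` and `y ∈ δ^∨`,
`inf { y(x') : x' ∈ (x + W) ∩ δ } + inf { y'(x) : y' ∈ (y + W^⊥) ∩ δ^∨ } = y(x)`. -/
theorem polyhedral_cone_inf_add_inf_eq
    {V : Type*} [AddCommGroup V] [Module ℝ V] [FiniteDimensional ℝ V]
    (δ : Set V)
    (hδ : ∃ s : Finset V,
      δ = { x | ∃ c : V → ℝ, (∀ v, 0 ≤ c v) ∧ x = ∑ v ∈ s, c v • v })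
    (W : Submodule ℝ V)
    (x : V) (hx : x ∈ δ)
    (y : Module.Dual ℝ V) (hy : ∀ z ∈ δ, 0 ≤ y z) :
    sInf { r : ℝ | ∃ x' ∈ δ, x' - x ∈ W ∧ r = y x' } +
      sInf { r : ℝ | ∃ y' : Module.Dual ℝ V,
        (∀ z ∈ δ, 0 ≤ y' z) ∧ y' - y ∈ W.dualAnnihilator ∧ r = y' x } = y x := by
  set A : Set ℝ := { r : ℝ | ∃ x' ∈ δ, x' - x ∈ W ∧ r = y x' } with hA
  set B : Set ℝ := { r : ℝ | ∃ y' : Module.Dual ℝ V,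
        (∀ z ∈ δ, 0 ≤ y' z) ∧ y' - y ∈ W.dualAnnihilator ∧ r = y' x } with hB
  have hAne : y x ∈ A := ⟨x, hx, by simp, rfl⟩
  have hBne : y x ∈ B := ⟨y, hy, by simp, rfl⟩
  have hA0 : ∀ r ∈ A, 0 ≤ r := by rintro r ⟨x', h, -, rfl⟩; exact hy x' h
  have hB0 : ∀ r ∈ B, 0 ≤ r := by rintro r ⟨y', h, -, rfl⟩; exact h x hx
  have hAb : BddBelow A := ⟨0, hA0⟩
  have hBb : BddBelow B := ⟨0, hB0⟩
  have hm0 : 0 ≤ sInf A := Real.sInf_nonneg hA0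
  apply le_antisymm
  · by_cases hxW : x ∈ W
    · have h0 : (0 : ℝ) ∈ A := by
        refine ⟨0, ?_, by simpa using hxW, by simp⟩
        obtain ⟨s, rfl⟩ := hδ
        exact ⟨0, by simp, by simp⟩
      have h1 := csInf_le hAb h0
      have h2 := csInf_le hBb hBne
      linarith
    obtain ⟨h, hhx, hhW⟩ := exists_dual_one_aux W x hxW
    obtain ⟨s, hs⟩ := hδ
    obtain ⟨g, hgE, hgs⟩ := cone_extension_aux s (W ⊔ Submodule.span ℝ {x})
      (y - sInf A • h) (by
        intro c hc hE
        obtain ⟨w, hw, z, hz, hwz⟩ := Submodule.mem_sup.1 hE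
        obtain ⟨t, rfl⟩ := Submodule.mem_span_singleton.1 hz
        have hmem : w + t • x ∈ δ := by rw [hs, hwz]; exact ⟨c, hc, rfl⟩
        have hval : (y - sInf A • h) (∑ v ∈ s, c v • v) = y (w + t • x) - sInf A * t := by
          rw [← hwz]; simp [hhx, hhW w hw]
        rw [hval]
        rcases le_or_gt t 0 with ht | ht
        · have := hy _ hmem
          nlinarith
        · have h1 : t⁻¹ * y (w + t • x) ∈ A := by
            refine ⟨t⁻¹ • (w + t • x), ?_, ?_, by rw [map_smul, smul_eq_mul]⟩
            · rw [hs, hwz]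
              refine ⟨fun v => t⁻¹ * c v, fun v => mul_nonneg (by positivity) (hc v), ?_⟩
              simp [Finset.smul_sum, mul_smul]
            · rw [smul_add, inv_smul_smul₀ ht.ne', add_sub_cancel_right]
              exact W.smul_mem _ hw
          have h2 := csInf_le hAb h1
          have h3 := mul_le_mul_of_nonneg_left h2 ht.le
          rw [mul_inv_cancel_left₀ ht.ne'] at h3
          linarith)
    have hmB : y x - sInf A ∈ B := by
      refine ⟨g, ?_, ?_, ?_⟩
      · intro z hz
        rw [hs] at hz
        obtain ⟨c, hc, rfl⟩ := hz
        rw [map_sum]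
        refine Finset.sum_nonneg fun v hv => ?_
        rw [map_smul, smul_eq_mul]
        exact mul_nonneg (hc v) (hgs v hv)
      · rw [Submodule.mem_dualAnnihilator]
        intro w hw
        rw [LinearMap.sub_apply, hgE w (Submodule.mem_sup_left hw)]
        simp [hhW w hw]
      · rw [hgE x (Submodule.mem_sup_right (Submodule.mem_span_singleton_self x))]
        simp [hhx]
    have := csInf_le hBb hmB
    linarith
  · have h1 : y x - sInf B ≤ sInf A := by
      refine le_csInf ⟨_, hAne⟩ ?_
      rintro r ⟨x', hx', hxW, rfl⟩
      have h2 : y x - y x' ≤ sInf B := by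
        refine le_csInf ⟨_, hBne⟩ ?_
        rintro r ⟨y', hy', hyW, rfl⟩
        have h3 := (Submodule.mem_dualAnnihilator _).1 hyW _ hxW
        have h4 := hy' x' hx'
        simp only [LinearMap.sub_apply, map_sub] at h3
        linarith
      linarith
    linarith
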